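/- Let d ∈ ℕ and let S ⊆ ℤ^d be a finite symmetric generating set of ℤ^d. Then β_{ℤ^d,S}(r) ≥ β_d(r) for all r ∈ ℕ. -/

import Mathlib

/-- `S` is a monoid generating set of the group `G`: every element of `G` is a
product of finitely many elements of `S`. -/
def IsMonGenSet {G : Type*} [Group G] (S : Set G) : Prop := Submonoid.closure S = ⊤

/-- `S` is symmetric: closed under inverses. -/
def IsSymmSet {G : Type*} [Group G] (S : Set G) : Prop := ∀ s ∈ S, s⁻¹ ∈ S

/-- The word length of `g` with respect to `S`: the least `n` such that `g` is a
product of `n` elements of `S`. -/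
noncomputable def wlen {G : Type*} [Group G] (S : Set G) (g : G) : ℕ :=
  sInf {n | ∃ l : List G, (∀ x ∈ l, x ∈ S) ∧ l.length = n ∧ l.prod = g}

/-- The growth function `β_{G,S}`: the cardinality of the ball of radius `r`. -/
noncomputable def growth {G : Type*} [Group G] (S : Set G) (r : ℕ) : ℕ :=
  Set.ncard {g : G | wlen S g ≤ r}

/-- The spherical growth function `σ_{G,S}`. -/
noncomputable def sph {G : Type*} [Group G] (S : Set G) (r : ℕ) : ℕ :=
  Set.ncard {g : G | wlen S g = r}

/-- The standard symmetric generating set `E_d ∪ (-E_d)` of `ℤ^d`. -/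
def stdSymmSet (d : ℕ) : Set (Multiplicative (Fin d → ℤ)) :=
  {x | ∃ i : Fin d, x = Multiplicative.ofAdd (Pi.single i 1) ∨
       x = Multiplicative.ofAdd (-Pi.single i 1)}

/-- The standard symmetric growth function `β_d` of `ℤ^d`. -/
noncomputable def betaStd (d : ℕ) : ℕ → ℕ := growth (stdSymmSet d)

/-- The standard monoid generating set `E_d ∪ {v_d}` of `ℤ^d`. -/
def stdMonSet (d : ℕ) : Set (Multiplicative (Fin d → ℤ)) :=
  {x | (∃ i : Fin d, x = Multiplicative.ofAdd (Pi.single i 1)) ∨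
       x = Multiplicative.ofAdd (fun _ => (-1 : ℤ))}

/-- The standard monoid growth function `β⁺_d` of `ℤ^d`. -/
noncomputable def betaPlus (d : ℕ) : ℕ → ℕ := growth (stdMonSet d)

/-- The rank of a finitely generated abelian group. -/
noncomputable def rk (G : Type*) [CommGroup G] : ℕ := Module.finrank ℤ (Additive G)

/-- With respect to a generating set, having word length at most `r` means being a product of
at most `r` generators. -/
theorem IsMonGenSet.wlen_le_iff {G : Type*} [Group G] {S : Set G} (hS : IsMonGenSet S)
    {g : G} {r : ℕ} :
    wlen S g ≤ r ↔ ∃ l : List G, (∀ x ∈ l, x ∈ S) ∧ l.length ≤ r ∧ l.prod = g := by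
  constructor
  · intro h
    have hg : g ∈ Submonoid.closure S := by rw [hS]; trivial
    obtain ⟨l, hl, hprod⟩ := Submonoid.exists_list_of_mem_closure hg
    obtain ⟨m, hm, hlen, hmprod⟩ :=
      Nat.sInf_mem (s := {n | ∃ l : List G, (∀ x ∈ l, x ∈ S) ∧ l.length = n ∧ l.prod = g})
        ⟨l.length, l, hl, rfl, hprod⟩
    exact ⟨m, hm, hlen.trans_le h, hmprod⟩
  · rintro ⟨l, hl, hlen, hprod⟩
    refine le_trans (Nat.sInf_le ?_) hlen
    exact ⟨l, hl, rfl, hprod⟩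

theorem IsMonGenSet.finite_ball {G : Type*} [Group G] {S : Set G} (hS : IsMonGenSet S)
    (hfin : S.Finite) (r : ℕ) : {g : G | wlen S g ≤ r}.Finite := by
  have := hfin.to_subtype
  refine ((List.finite_length_le S r).image fun l => (l.map Subtype.val).prod).subset ?_
  intro g hg
  obtain ⟨l, hl, hlen, hprod⟩ := hS.wlen_le_iff.1 hg
  lift l to List S using hl
  exact ⟨l, by simpa using hlen, hprod⟩

/-- An injective homomorphism mapping generators to generators does not decrease growth. -/
theorem growth_le_growth_of_injective {G H : Type*} [Group G] [Group H] {T : Set G} {S : Set H}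
    (hT : IsMonGenSet T) (hS : IsMonGenSet S) (hfin : S.Finite) (f : G →* H)
    (hf : Function.Injective f) (hmaps : ∀ t ∈ T, f t ∈ S) (r : ℕ) :
    growth T r ≤ growth S r := by
  refine Set.ncard_le_ncard_of_injOn f ?_ hf.injOn (hS.finite_ball hfin r)
  intro g hg
  obtain ⟨l, hl, hlen, rfl⟩ := hT.wlen_le_iff.1 hg
  refine hS.wlen_le_iff.2 ⟨l.map f, ?_, by simpa using hlen, (map_list_prod f l).symm⟩
  simpa using fun x hx => hmaps x (hl x hx)

theorem isMonGenSet_stdSymmSet (d : ℕ) : IsMonGenSet (stdSymmSet d) := by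
  have hpos (i : Fin d) (n : ℕ) :
      Multiplicative.ofAdd (Pi.single i (n : ℤ)) ∈ Submonoid.closure (stdSymmSet d) := by
    have h := pow_mem (Submonoid.subset_closure (s := stdSymmSet d) ⟨i, Or.inl rfl⟩) n
    rwa [← ofAdd_nsmul, ← Pi.single_smul, nsmul_one] at h
  have hneg (i : Fin d) (n : ℕ) :
      Multiplicative.ofAdd (Pi.single i (-n : ℤ)) ∈ Submonoid.closure (stdSymmSet d) := by
    have h := pow_mem (Submonoid.subset_closure (s := stdSymmSet d) ⟨i, Or.inr rfl⟩) n
    rwa [← ofAdd_nsmul, ← Pi.single_neg, ← Pi.single_smul, smul_neg, nsmul_one] at h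
  refine eq_top_iff.2 fun g _ => ?_
  rw [← ofAdd_toAdd g, ← Finset.univ_sum_single g.toAdd, ofAdd_sum]
  refine prod_mem fun i _ => ?_
  obtain ⟨n, hn | hn⟩ := (g.toAdd i).eq_nat_or_neg
  · exact hn ▸ hpos i n
  · exact hn ▸ hneg i n

theorem IsMonGenSet.span_int_eq_top {M : Type*} [AddCommGroup M] {S : Set (Multiplicative M)}
    (hS : IsMonGenSet S) : Submodule.span ℤ (Multiplicative.ofAdd ⁻¹' S) = ⊤ := by
  refine eq_top_iff.2 fun x _ => ?_
  have hx : Multiplicative.ofAdd x ∈ Submonoid.closure S := by rw [hS]; trivial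
  obtain ⟨l, hl, hprod⟩ := Submonoid.exists_list_of_mem_closure hx
  have hsum : (l.map Multiplicative.toAdd).sum = x := by rw [← toAdd_list_sum, hprod, toAdd_ofAdd]
  rw [← hsum]
  refine list_sum_mem fun y hy => ?_
  obtain ⟨z, hz, rfl⟩ := List.mem_map.1 hy
  exact Submodule.subset_span (hl z hz)

/-- A spanning set of `ℤ^d` contains `d` linearly independent vectors. -/
theorem exists_linearIndependent_int_of_span_eq_top {d : ℕ} {T : Set (Fin d → ℤ)}
    (hT : Submodule.span ℤ T = ⊤) :
    ∃ v : Fin d → Fin d → ℤ, (∀ i, v i ∈ T) ∧ LinearIndependent ℤ v := by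
  let c : (Fin d → ℤ) →ₗ[ℤ] (Fin d → ℚ) := (Algebra.linearMap ℤ ℚ).compLeft (Fin d)
  have hspan : Submodule.span ℚ (c '' T) = ⊤ := by
    have hc (x : Fin d → ℤ) : c x ∈ Submodule.span ℚ (c '' T) := by
      have hx : c x ∈ (Submodule.span ℤ T).map c := by rw [hT]; exact ⟨x, trivial, rfl⟩
      rw [Submodule.map_span] at hx
      exact Submodule.span_le_restrictScalars ℤ ℚ _ hx
    refine eq_top_iff.2 ((Pi.basisFun ℚ (Fin d)).span_eq.ge.trans (Submodule.span_le.2 ?_))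
    rintro _ ⟨i, rfl⟩
    have hi : c (Pi.single i 1) = Pi.basisFun ℚ (Fin d) i := by
      ext j
      simp [c, Pi.single_apply, apply_ite]
    exact hi ▸ hc _
  obtain ⟨b, hbT, hbspan, hb⟩ := exists_linearIndependent ℚ (c '' T)
  let B : Module.Basis b ℚ (Fin d → ℚ) := .mk hb (by simp [hbspan, hspan])
  let e : Fin d ≃ b := (Pi.basisFun ℚ (Fin d)).indexEquiv B
  choose v hvT hv using fun i => hbT (e i).2
  refine ⟨v, hvT, .of_comp c ?_⟩
  have hcv : c ∘ v = Subtype.val ∘ e := funext hv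
  rw [hcv]
  exact (hb.comp e e.injective).restrict_scalars' ℤ

/-- Minimal growth of free Abelian groups, symmetric case: every finite symmetric
generating set of `ℤ^d` has growth function at least `β_d`. -/
theorem betaStd_le_growth (d : ℕ) (S : Set (Multiplicative (Fin d → ℤ)))
    (hS : S.Finite) (hsymm : IsSymmSet S) (hgen : IsMonGenSet S) :
    ∀ r : ℕ, betaStd d r ≤ growth S r := by
  intro r
  obtain ⟨v, hvS, hv⟩ := exists_linearIndependent_int_of_span_eq_top hgen.span_int_eq_top
  let f := (Fintype.linearCombination ℤ v).toAddMonoidHom.toMultiplicative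
  have hf (i : Fin d) : f (Multiplicative.ofAdd (Pi.single i 1)) = Multiplicative.ofAdd (v i) := by
    simp [f, Fintype.linearCombination_apply_single]
  refine growth_le_growth_of_injective (isMonGenSet_stdSymmSet d) hgen hS f
    (hv.fintypeLinearCombination_injective) ?_ r
  rintro _ ⟨i, rfl | rfl⟩
  · rw [hf]
    exact hvS i
  · rw [ofAdd_neg, map_inv, hf]
    exact hsymm _ (hvS i)
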